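/- Let d = (d(1),…,d(n)) be a degree sequence with d(i) ≥ 1 for all i and ∑_{i=1}^n d(i) = 2m even with 2m ≥ 2n. Then for any tree-rooted graph (g,t,γ), where g is a multigraph on [n] with degree sequence d, t is a spanning tree of g, and γ is an oriented edge whose underlying edge satisfies m_{g−t}(γ) ≥ 1, the random tree-rooted graph (G(d),T(d),Γ(d)) satisfies P((G(d),T(d),Γ(d)) = (g,t,γ)) = [∏_{i=1}^n (d(i)−1)!] · [2^{m−n}·(m−n)!/(2m−n)!] · [2^{1{γ is a loop}}·m_{g−t}(γ)] / [∏_{i=1}^n 2^{m_{g−t}(ii)} · ∏_{e∈e(g)} m_{g−t}(e)!]. In particular, this probability is proportional, over all tree-rooted graphs (g,t,γ) with degree sequence d, to 2^{1{γ is a loop}}·m_{g−t}(γ) / (∏_{i=1}^n 2^{m_{g−t}(ii)} · ∏_{e∈e(g)} m_{g−t}(e)!). -/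

import Mathlib

open Classical Filter

namespace TWG

/-- Half-edges for the degree sequence `d`: vertex `i` carries `d i` half-edges,
encoded as `⟨i, j⟩` for `j : Fin (d i)`; `⟨i, d i - 1⟩` is the root half-edge of `i`. -/
abbrev HE {n : ℕ} (d : Fin n → ℕ) := (i : Fin n) × Fin (d i)

def IsRootHE {n : ℕ} (d : Fin n → ℕ) (h : HE d) : Prop := (h.2 : ℕ) = d h.1 - 1

def IsNonRootHE {n : ℕ} (d : Fin n → ℕ) (h : HE d) : Prop := (h.2 : ℕ) < d h.1 - 1

/-- A candidate execution path: at each of the `n-1` steps, a pair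
(root half-edge `r_k`, non-root half-edge `s_k`) is chosen. -/
abbrev Path {n : ℕ} (d : Fin n → ℕ) := Fin (n - 1) → HE d × HE d

/-- Vertices `a` and `b` lie in the same tree of the forest present at the start of
step `k`, i.e. they are joined by the edges created at steps `j < k`. -/
def SameTree {n : ℕ} {d : Fin n → ℕ} (E : Path d) (k : Fin (n - 1)) (a b : Fin n) : Prop :=
  Relation.ReflTransGen
    (fun x y => ∃ j, j < k ∧
      (((E j).1.1 = x ∧ (E j).2.1 = y) ∨ ((E j).1.1 = y ∧ (E j).2.1 = x))) a b

/-- `E` is a valid execution path of Pitman's additive coalescent for `d`: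
at each step, `r_k` is an as-yet-unpaired root half-edge, `s_k` is an
as-yet-unpaired non-root half-edge, and they lie in different trees of the
current forest. -/
def IsExecPath {n : ℕ} (d : Fin n → ℕ) (E : Path d) : Prop :=
  ∀ k : Fin (n - 1),
    IsRootHE d (E k).1 ∧ IsNonRootHE d (E k).2 ∧
    (∀ j, j < k → (E j).1 ≠ (E k).1) ∧
    (∀ j, j < k → (E j).2 ≠ (E k).2) ∧
    ¬ SameTree E k (E k).1.1 (E k).2.1

/-- The number of children of vertex `i` in the tree `T(d)` built by `E`. -/
noncomputable def cc {n : ℕ} {d : Fin n → ℕ} (E : Path d) (i : Fin n) : ℕ :=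
  Nat.card {k : Fin (n - 1) // (E k).2.1 = i}

/-- `v` is a non-root vertex of the tree built by `E`. -/
def IsNonRootV {n : ℕ} {d : Fin n → ℕ} (E : Path d) (v : Fin n) : Prop :=
  ∃ k, (E k).1.1 = v

/-- The parent of `v` in the tree built by `E` (equal to `v` itself for the root). -/
noncomputable def parentOf {n : ℕ} {d : Fin n → ℕ} (E : Path d) (v : Fin n) : Fin n :=
  if h : ∃ k, (E k).1.1 = v then (E h.choose).2.1 else v

/-- The tree built by `E` is the rooted tree with root `root` and parent map `par`. -/
def TreeEq {n : ℕ} {d : Fin n → ℕ} (E : Path d) (root : Fin n) (par : Fin n → Fin n) : Prop :=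
  (∀ k, par (E k).1.1 = (E k).2.1) ∧ ∀ v, v ≠ root → ∃ k, (E k).1.1 = v

/-- `(root, par)` encodes a rooted tree on `Fin n`: the root is a fixed point of the
parent map and every vertex reaches the root by iterating the parent map. -/
def IsRootedTree {n : ℕ} (root : Fin n) (par : Fin n → Fin n) : Prop :=
  par root = root ∧ ∀ v, ∃ m, par^[m] v = root

/-- The number of children of `i` in the rooted tree `(root, par)`. -/
noncomputable def childCount {n : ℕ} (root : Fin n) (par : Fin n → Fin n) (i : Fin n) : ℕ :=
  Nat.card {v : Fin n // v ≠ root ∧ par v = i}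

/-- `h` is one of the half-edges paired during the execution path `E`. -/
def UsedIn {n : ℕ} {d : Fin n → ℕ} (E : Path d) (h : HE d) : Prop :=
  (∃ k, (E k).1 = h) ∨ (∃ k, (E k).2 = h)

/-- `M` pairs up, as a fixed-point-free involution, exactly the half-edges left
unpaired by `E` (its fixed points are exactly the half-edges used by `E`). -/
def IsCompletion {n : ℕ} {d : Fin n → ℕ} (E : Path d) (M : HE d → HE d) : Prop :=
  Function.Involutive M ∧ ∀ h, (M h = h ↔ UsedIn E h)

/-- The number of half-edges at `u`, unpaired by `E`, which `M` matches to a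
half-edge at `v`.  For `u ≠ v` this is the number of `M`-edges joining `u` and `v`;
for `u = v` it is twice the number of `M`-loops at `u`. -/
noncomputable def matchCount {n : ℕ} {d : Fin n → ℕ} (E : Path d) (M : HE d → HE d)
    (u v : Fin n) : ℕ :=
  Nat.card {h : HE d // ¬ UsedIn E h ∧ h.1 = u ∧ (M h).1 = v}

/-- `P(Bin(m, ρ) = a)`. -/
noncomputable def binomP (ρ : ℝ) (m a : ℕ) : ℝ :=
  (m.choose a : ℝ) * ρ ^ a * (1 - ρ) ^ (m - a)


/-- The number of `t`-edges between `u` and `v` (for `u ≠ v`), where `t` is the rooted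
tree `(root, par)`. -/
noncomputable def treeEdgeNum {n : ℕ} (root : Fin n) (par : Fin n → Fin n)
    (u v : Fin n) : ℕ :=
  (if u ≠ root ∧ par u = v then 1 else 0) + (if v ≠ root ∧ par v = u then 1 else 0)

/-- The multiplicity `m_{g-t}` of the pair `{u,v}` in `g - t`, where the multigraph `g`
is given by its multiplicity function (`g u u` is the number of loops at `u`) and `t`
is the rooted tree `(root, par)` (`t` has no loops). -/
noncomputable def multMinusTree {n : ℕ} (g : Fin n → Fin n → ℕ) (root : Fin n)
    (par : Fin n → Fin n) (u v : Fin n) : ℕ :=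
  if u = v then g u u else g u v - treeEdgeNum root par u v

/-- The pair `(E, M)` produces the multigraph `g`: between distinct vertices the tree
edges plus matched pairs realize the multiplicities of `g`, and at each vertex the
matched half-edge pairs realize the loops of `g` (each loop is seen from both of its
half-edges, whence the factor 2). -/
noncomputable def GraphEq {n : ℕ} {d : Fin n → ℕ} (E : Path d) (M : HE d → HE d)
    (g : Fin n → Fin n → ℕ) (root : Fin n) (par : Fin n → Fin n) : Prop :=
  (∀ u v, u ≠ v → treeEdgeNum root par u v + matchCount E M u v = g u v)
    ∧ ∀ u, matchCount E M u u = 2 * g u u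


section Matching

def MSet {H : Type} (S : Finset H) (M : H → H) : Prop :=
  Function.Involutive M ∧ ∀ h, (M h = h ↔ h ∉ S)

noncomputable def cnt {H : Type} {c : ℕ} (π : H → Fin c) (S : Finset H) (M : H → H)
    (u v : Fin c) : ℕ :=
  (S.filter (fun h => π h = u ∧ π (M h) = v)).card

def NN {c : ℕ} (m : Fin c → Fin c → ℕ) (u v : Fin c) : ℕ :=
  m u v + if u = v then m u v else 0

noncomputable def QQ {H : Type} [Fintype H] {c : ℕ} (π : H → Fin c) (S : Finset H)
    (m : Fin c → Fin c → ℕ) : Finset (H → H) :=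
  Finset.univ.filter (fun M => MSet S M ∧ ∀ u v, cnt π S M u v = NN m u v)

lemma mem_QQ {H : Type} [Fintype H] {c : ℕ} (π : H → Fin c) (S : Finset H)
    (m : Fin c → Fin c → ℕ) (M : H → H) :
    M ∈ QQ π S m ↔ MSet S M ∧ ∀ u v, cnt π S M u v = NN m u v := by
  simp [QQ]

noncomputable def DD {c : ℕ} (m : Fin c → Fin c → ℕ) : ℕ :=
  (∏ i, 2 ^ (m i i)) *
    ∏ x ∈ Finset.univ.filter (fun x : Fin c × Fin c => x.1 ≤ x.2), (m x.1 x.2).factorial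

noncomputable def ell {H : Type} {c : ℕ} (π : H → Fin c) (S : Finset H) (u : Fin c) : ℕ :=
  (S.filter (fun h => π h = u)).card

noncomputable def decm {c : ℕ} (m : Fin c → Fin c → ℕ) (a b : Fin c) : Fin c → Fin c → ℕ :=
  fun u v => if (u = a ∧ v = b) ∨ (u = b ∧ v = a) then m u v - 1 else m u v

lemma prod_pull {ι : Type} (s : Finset ι) (p : ι) (hp : p ∈ s) (f f' : ι → ℕ) (K : ℕ)
    (h : ∀ x ∈ s, x ≠ p → f x = f' x) (hK : f p = f' p * K) :
    ∏ x ∈ s, f x = (∏ x ∈ s, f' x) * K := by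
  rw [← Finset.mul_prod_erase s f hp, ← Finset.mul_prod_erase s f' hp, hK,
    Finset.prod_congr rfl (g := f')]
  · ring
  · intro x hx
    exact h x (Finset.mem_of_mem_erase hx) (Finset.ne_of_mem_erase hx)

lemma DD_dec {c : ℕ} (m : Fin c → Fin c → ℕ) (hm : ∀ u v, m u v = m v u) (a b : Fin c)
    (h1 : 1 ≤ m a b) : DD m = DD (decm m a b) * NN m a b := by
  obtain ⟨k, hk⟩ : ∃ k, m a b = k + 1 := ⟨m a b - 1, by omega⟩
  have h2 : ∏ x ∈ Finset.univ.filter (fun x : Fin c × Fin c => x.1 ≤ x.2),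
      (m x.1 x.2).factorial =
      (∏ x ∈ Finset.univ.filter (fun x : Fin c × Fin c => x.1 ≤ x.2),
        (decm m a b x.1 x.2).factorial) * m a b := by
    apply prod_pull _ (min a b, max a b)
    · simp
    · rintro ⟨x, y⟩ hxy hne
      simp only [Finset.mem_filter, Finset.mem_univ, true_and] at hxy
      simp only [decm]
      rw [if_neg]
      rintro (⟨rfl, rfl⟩ | ⟨rfl, rfl⟩)
      · apply hne; simp [hxy]
      · apply hne; simp [hxy]
    · rcases le_total a b with h | h
      · simp [h, decm, hk, Nat.factorial_succ]; ring
      · simp [h, decm, hm b a, hk, Nat.factorial_succ]; ring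
  unfold DD
  rw [h2]
  by_cases hab : a = b
  · subst hab
    have h3 : ∏ i, 2 ^ (m i i) = (∏ i, 2 ^ (decm m a a i i)) * 2 := by
      apply prod_pull _ a (Finset.mem_univ _)
      · intro x _ hx
        simp [decm, hx]
      · simp [decm, hk, pow_succ]
    rw [h3]; simp [NN]; ring
  · have h3 : ∏ i, 2 ^ (m i i) = (∏ i, 2 ^ (decm m a b i i)) := by
      apply Finset.prod_congr rfl
      intro x _
      have : ¬ ((x = a ∧ x = b) ∨ (x = b ∧ x = a)) := by
        rintro (⟨rfl, h⟩ | ⟨rfl, h⟩) <;> simp_all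
      simp [decm, this]
    rw [h3]; simp [NN, hab]; ring

lemma NN_dec {c : ℕ} (m : Fin c → Fin c → ℕ) (hm : ∀ u v, m u v = m v u) (a b : Fin c)
    (h1 : 1 ≤ m a b) (u v : Fin c) : NN m u v = NN (decm m a b) u v
      + (if u = a ∧ v = b then 1 else 0) + (if u = b ∧ v = a then 1 else 0) := by
  have := hm a b
  unfold NN decm
  by_cases h : u = a ∧ v = b
  · obtain ⟨rfl, rfl⟩ := h
    by_cases h' : u = v
    · subst h'; simp; omega
    · simp [h']; omega
  · by_cases h' : u = b ∧ v = a
    · obtain ⟨rfl, rfl⟩ := h'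
      have : u ≠ v := fun h'' => h (by simp [h''])
      simp [this]; omega
    · simp [h, h']

lemma ell_insert {H : Type} {c : ℕ} (π : H → Fin c) (S : Finset H) (h : H) (hS : h ∉ S)
    (u : Fin c) : ell π (insert h S) u = ell π S u + if u = π h then 1 else 0 := by
  unfold ell
  rw [Finset.filter_insert]
  by_cases hu : π h = u
  · simp [hu, hS]
  · simp [hu, Ne.symm hu]

lemma prod_ell_insert {H : Type} {c : ℕ} (π : H → Fin c) (S : Finset H) (h : H) (hS : h ∉ S) :
    ∏ u, (ell π (insert h S) u).factorial
      = (∏ u, (ell π S u).factorial) * (ell π S (π h) + 1) := by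
  apply prod_pull _ (π h) (Finset.mem_univ _)
  · intro x _ hx
    simp [ell_insert π S h hS, hx]
  · simp [ell_insert π S h hS, Nat.factorial_succ]; ring

lemma cnt_insert {H : Type} {c : ℕ} (π : H → Fin c) (S' : Finset H) (h0 h1 : H)
    (h01 : h0 ≠ h1) (hS0 : h0 ∉ S') (hS1 : h1 ∉ S') (M M' : H → H) (hM0 : M h0 = h1)
    (hM1 : M h1 = h0) (hM : ∀ x, x ≠ h0 → x ≠ h1 → M x = M' x) (u v : Fin c) :
    cnt π (insert h0 (insert h1 S')) M u v = cnt π S' M' u v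
      + (if u = π h0 ∧ v = π h1 then 1 else 0) + (if u = π h1 ∧ v = π h0 then 1 else 0) := by
  unfold cnt
  have h2 : S'.filter (fun h => π h = u ∧ π (M h) = v)
      = S'.filter (fun h => π h = u ∧ π (M' h) = v) := by
    apply Finset.filter_congr
    intro x hx
    rw [hM x (fun h => hS0 (h ▸ hx)) (fun h => hS1 (h ▸ hx))]
  rw [Finset.card_filter, Finset.sum_insert (by simp [h01, hS0]), Finset.sum_insert hS1,
    ← Finset.card_filter, h2, hM0, hM1]
  simp only [eq_comm (a := u), eq_comm (a := v)]
  ring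

lemma step_card {H : Type} [Fintype H] {c : ℕ} (π : H → Fin c) (S' : Finset H) (h0 h1 : H)
    (h01 : h0 ≠ h1) (hS0 : h0 ∉ S') (hS1 : h1 ∉ S') (m : Fin c → Fin c → ℕ)
    (hm : ∀ u v, m u v = m v u) (hpos : 1 ≤ m (π h0) (π h1)) :
    ((QQ π (insert h0 (insert h1 S')) m).filter (fun M => M h0 = h1)).card
      = (QQ π S' (decm m (π h0) (π h1))).card := by
  apply Finset.card_bij' (fun M _ => fun x => if x = h0 ∨ x = h1 then x else M x)
    (fun M _ => fun x => if x = h0 then h1 else if x = h1 then h0 else M x)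
  · intro M hM
    simp only [mem_QQ, MSet, Finset.mem_filter, Finset.mem_univ, true_and] at hM ⊢
    obtain ⟨⟨⟨hinv, hfix⟩, hc⟩, hM0⟩ := hM
    have hM1 : M h1 = h0 := by rw [← hM0, hinv]
    refine ⟨⟨?_, ?_⟩, ?_⟩
    · intro x
      by_cases hx : x = h0 ∨ x = h1
      · simp [hx]
      · have : ¬ (M x = h0 ∨ M x = h1) := by
          rintro (h | h)
          · apply hx; right; rw [← hinv x, h, hM0]
          · apply hx; left; rw [← hinv x, h, hM1]
        simp [hx, this, hinv x]
    · intro x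
      by_cases hx : x = h0 ∨ x = h1
      · simp only [hx, if_true, true_iff]
        rcases hx with rfl | rfl <;> assumption
      · simp only [hx, if_false]
        rw [hfix]
        push Not at hx
        simp [hx.1, hx.2]
    · intro u v
      have := hc u v
      rw [NN_dec m hm _ _ hpos, cnt_insert π S' h0 h1 h01 hS0 hS1 M
        (fun x => if x = h0 ∨ x = h1 then x else M x) hM0 hM1 (by
          intro x hx hx'; simp [hx, hx'])] at this
      omega
  · intro M hM
    simp only [mem_QQ, MSet, Finset.mem_filter, Finset.mem_univ, true_and] at hM ⊢
    obtain ⟨⟨hinv, hfix⟩, hc⟩ := hM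
    have f0 : M h0 = h0 := (hfix h0).2 hS0
    have f1 : M h1 = h1 := (hfix h1).2 hS1
    refine ⟨⟨⟨?_, ?_⟩, ?_⟩, by simp⟩
    · intro x
      by_cases hx : x = h0
      · simp [hx, h01.symm]
      · by_cases hx' : x = h1
        · simp [hx', h01.symm]
        · have e0 : M x ≠ h0 := by
            intro h; apply hx; rw [← hinv x, h, f0]
          have e1 : M x ≠ h1 := by
            intro h; apply hx'; rw [← hinv x, h, f1]
          simp [hx, hx', e0, e1, hinv x]
    · intro x
      by_cases hx : x = h0
      · simp [hx, h01.symm]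
      · by_cases hx' : x = h1
        · simp [hx', h01.symm, h01]
        · simp [hx, hx', hfix]
    · intro u v
      rw [NN_dec m hm _ _ hpos, cnt_insert π S' h0 h1 h01 hS0 hS1 _ M (by simp)
        (by simp [h01.symm]) (by intro x hx hx'; simp [hx, hx']), hc]
  · intro M hM
    simp only [mem_QQ, MSet, Finset.mem_filter, Finset.mem_univ, true_and] at hM
    obtain ⟨⟨⟨hinv, hfix⟩, hc⟩, hM0⟩ := hM
    have hM1 : M h1 = h0 := by rw [← hM0, hinv]
    funext x
    by_cases hx : x = h0
    · simp [hx, hM0]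
    · by_cases hx' : x = h1
      · simp [hx', hM1]
      · simp [hx, hx']
  · intro M hM
    simp only [mem_QQ, MSet, Finset.mem_filter, Finset.mem_univ, true_and] at hM
    obtain ⟨⟨hinv, hfix⟩, hc⟩ := hM
    have f0 : M h0 = h0 := (hfix h0).2 hS0
    have f1 : M h1 = h1 := (hfix h1).2 hS1
    funext x
    by_cases hx : x = h0
    · simp [hx, f0]
    · by_cases hx' : x = h1
      · simp [hx', f1]
      · simp [hx, hx']

def MatchIH {H : Type} [Fintype H] {c : ℕ} (π : H → Fin c) (k : ℕ) : Prop :=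
  ∀ (S : Finset H) (m : Fin c → Fin c → ℕ), S.card < k → (∀ u v, m u v = m v u) →
    (∀ u, ell π S u = ∑ v, NN m u v) →
    (QQ π S m).card * DD m = ∏ u, (ell π S u).factorial

lemma rooted_of_IH {H : Type} [Fintype H] {c : ℕ} (π : H → Fin c) (S : Finset H)
    (m : Fin c → Fin c → ℕ) (IH : MatchIH π S.card)
    (hm : ∀ u v, m u v = m v u) (hl : ∀ u, ell π S u = ∑ v, NN m u v)
    (h0 : H) (hh0 : h0 ∈ S) (v : Fin c) :
    ((QQ π S m).filter (fun M => π (M h0) = v)).card * DD m * ell π S (π h0)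
      = NN m (π h0) v * ∏ u, (ell π S u).factorial := by
  by_cases hpos : m (π h0) v = 0
  · have h1 : NN m (π h0) v = 0 := by simp [NN, hpos]
    have h2 : (QQ π S m).filter (fun M => π (M h0) = v) = ∅ := by
      rw [Finset.filter_eq_empty_iff]
      intro M hM hv
      simp only [mem_QQ, Finset.mem_filter, Finset.mem_univ, true_and] at hM
      have := hM.2 (π h0) v
      rw [h1, cnt, Finset.card_eq_zero, Finset.filter_eq_empty_iff] at this
      exact this hh0 ⟨rfl, hv⟩
    simp [h1, h2]
  · set B := S.filter (fun h => π h = v ∧ h ≠ h0) with hB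
    have key : ∀ h1 ∈ B, ((QQ π S m).filter (fun M => M h0 = h1)).card * DD m
        * ell π S (π h0) * B.card = NN m (π h0) v * ∏ u, (ell π S u).factorial := by
      intro h1 hh1
      simp only [hB, Finset.mem_filter] at hh1
      obtain ⟨h1S, h1v, h10⟩ := hh1
      set S' := (S.erase h0).erase h1 with hS'
      have hS0 : h0 ∉ S' := by simp [hS']
      have hS1 : h1 ∉ S' := by simp [hS']
      have hSe : S = insert h0 (insert h1 S') := by
        rw [hS', Finset.insert_erase (by simp [h1S, h10]), Finset.insert_erase hh0]
      have hS0' : h0 ∉ insert h1 S' := by simp [hS0, h10.symm]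
      have hcard : S'.card < S.card := by
        rw [hSe, Finset.card_insert_of_notMem hS0', Finset.card_insert_of_notMem hS1]; omega
      have hpos' : 1 ≤ m (π h0) (π h1) := by rw [h1v]; omega
      have hl' : ∀ u, ell π S' u = ∑ w, NN (decm m (π h0) (π h1)) u w := by
        intro u
        have h := hl u
        rw [hSe, ell_insert π _ _ hS0', ell_insert π _ _ hS1,
          Finset.sum_congr rfl (fun w _ => NN_dec m hm _ _ hpos' u w),
          Finset.sum_add_distrib, Finset.sum_add_distrib] at h
        have e1 : ∑ w, (if u = π h0 ∧ w = π h1 then 1 else 0) = if u = π h0 then 1 else 0 := by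
          by_cases hu : u = π h0 <;> simp [hu]
        have e2 : ∑ w, (if u = π h1 ∧ w = π h0 then 1 else 0) = if u = π h1 then 1 else 0 := by
          by_cases hu : u = π h1 <;> simp [hu]
        rw [e1, e2] at h
        omega
      have hmd : ∀ u w, decm m (π h0) (π h1) u w = decm m (π h0) (π h1) w u := by
        intro u w
        unfold decm
        rw [hm u w]
        congr 1
        apply propext
        tauto
      have ih := IH S' (decm m (π h0) (π h1)) hcard hmd hl'
      have hBc : B.card = ell π S' v + 1 := by
        have : B = (insert h1 S').filter (fun h => π h = v) := by
          ext x
          rw [hB, hSe]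
          simp only [Finset.mem_filter, Finset.mem_insert]
          constructor
          · rintro ⟨h | h, h', h''⟩
            · exact absurd h h''
            · exact ⟨h, h'⟩
          · rintro ⟨h, h'⟩
            refine ⟨Or.inr h, h', ?_⟩
            rintro rfl
            exact hS0' (by simpa using h)
        rw [this]
        have := ell_insert π S' h1 hS1 v
        simpa [ell, h1v] using this
      have hla : ell π S (π h0) = ell π (insert h1 S') (π h0) + 1 := by
        rw [hSe, ell_insert π _ _ hS0']; simp
      have hprod : ∏ u, (ell π S u).factorial
          = (∏ u, (ell π S' u).factorial) * B.card * ell π S (π h0) := by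
        rw [hla, hBc, ← h1v, ← prod_ell_insert π S' h1 hS1, ← prod_ell_insert π _ h0 hS0', hSe]
      have hst := step_card π S' h0 h1 h10.symm hS0 hS1 m hm hpos'
      rw [← hSe] at hst
      rw [hst, hprod, DD_dec m hm _ _ hpos', ← ih, h1v]
      ring
    have hBpos : 0 < B.card := by
      have h1 : NN m v (π h0) ≤ ell π S v := by
        rw [hl v]; exact Finset.single_le_sum (f := fun w => NN m v w) (fun _ _ => Nat.zero_le _)
          (Finset.mem_univ _)
      rw [Finset.card_pos]
      by_contra hne
      rw [Finset.not_nonempty_iff_eq_empty, hB, Finset.filter_eq_empty_iff] at hne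
      by_cases hv : π h0 = v
      · have : ell π S v ≤ 1 := by
          unfold ell
          rw [Finset.card_le_one]
          have hx : ∀ x ∈ S.filter (fun h => π h = v), x = h0 := by
            intro x hx
            by_contra hxx
            exact hne (Finset.mem_of_mem_filter x hx) ⟨(Finset.mem_filter.1 hx).2, hxx⟩
          intro x hx' y hy
          rw [hx x hx', hx y hy]
        subst hv
        simp [NN] at h1
        omega
      · have : ell π S v = 0 := by
          unfold ell
          rw [Finset.card_eq_zero, Finset.filter_eq_empty_iff]
          intro x hx hxv
          exact hne hx ⟨hxv, fun h => hv (h ▸ hxv)⟩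
        have h3 := hm (π h0) v
        simp only [NN] at h1
        omega
    have hsum : ((QQ π S m).filter (fun M => π (M h0) = v)).card
        = ∑ h1 ∈ B, ((QQ π S m).filter (fun M => M h0 = h1)).card := by
      rw [Finset.card_eq_sum_card_fiberwise (f := fun M => M h0) (t := B)]
      · apply Finset.sum_congr rfl
        intro h1 hh1
        congr 1
        ext M
        simp only [Finset.mem_filter, hB] at hh1 ⊢
        constructor
        · rintro ⟨⟨h, _⟩, h'⟩; exact ⟨h, h'⟩
        · rintro ⟨h, h'⟩; exact ⟨⟨h, by rw [h']; exact hh1.2.1⟩, h'⟩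
      · intro M hM
        simp only [mem_QQ, MSet, Finset.coe_filter, Finset.mem_filter, Finset.mem_univ, true_and,
          Set.mem_ofPred_eq, hB] at hM ⊢
        obtain ⟨⟨⟨hinv, hfix⟩, -⟩, hv⟩ := hM
        have hne : M h0 ≠ h0 := fun h => (hfix h0).1 h hh0
        refine ⟨?_, hv, hne⟩
        by_contra hns
        have := (hfix (M h0)).2 hns
        rw [hinv] at this
        exact hne this.symm
    apply Nat.eq_of_mul_eq_mul_right hBpos
    rw [hsum, Finset.sum_mul, Finset.sum_mul, Finset.sum_mul, Finset.sum_congr rfl key,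
      Finset.sum_const, smul_eq_mul]
    ring

theorem matching_count {H : Type} [Fintype H] {c : ℕ} (π : H → Fin c) (k : ℕ) :
    MatchIH π k := by
  induction k with
  | zero => intro S m h; omega
  | succ k ih =>
    intro S m hS hm hl
    have IH : MatchIH π S.card := fun S' m' h' => ih S' m' (by omega)
    rcases S.eq_empty_or_nonempty with rfl | ⟨h0, hh0⟩
    · have hz : ∀ u v, m u v = 0 := by
        intro u v
        have h := hl u
        simp only [ell, Finset.filter_empty, Finset.card_empty] at h
        have := (Finset.sum_eq_zero_iff.1 h.symm) v (Finset.mem_univ _)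
        unfold NN at this
        omega
      have : QQ π ∅ m = {id} := by
        ext M
        simp only [mem_QQ, MSet, cnt, NN, hz, Finset.mem_filter, Finset.mem_univ, true_and,
          Finset.mem_singleton]
        constructor
        · rintro ⟨⟨_, h⟩, _⟩
          funext x
          exact (h x).2 (by simp)
        · rintro rfl
          simp [Function.Involutive]
      simp [this, DD, hz, ell]
    · have hlpos : 0 < ell π S (π h0) := by
        unfold ell
        rw [Finset.card_pos]
        exact ⟨h0, by simp [hh0]⟩
      have hsum : (QQ π S m).card = ∑ v, ((QQ π S m).filter (fun M => π (M h0) = v)).card :=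
        Finset.card_eq_sum_card_fiberwise (fun _ _ => by simp)
      apply Nat.eq_of_mul_eq_mul_right hlpos
      rw [hsum, Finset.sum_mul, Finset.sum_mul,
        Finset.sum_congr rfl (fun v _ => rooted_of_IH π S m IH hm hl h0 hh0 v),
        ← Finset.sum_mul, ← hl]
      ring

theorem rooted_count {H : Type} [Fintype H] {c : ℕ} (π : H → Fin c) (S : Finset H)
    (m : Fin c → Fin c → ℕ)
    (hm : ∀ u v, m u v = m v u) (hl : ∀ u, ell π S u = ∑ v, NN m u v)
    (h0 : H) (hh0 : h0 ∈ S) (v : Fin c) :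
    ((QQ π S m).filter (fun M => π (M h0) = v)).card * DD m * ell π S (π h0)
      = NN m (π h0) v * ∏ u, (ell π S u).factorial :=
  rooted_of_IH π S m (matching_count π _) hm hl h0 hh0 v

/-- Number of perfect matchings on a set of even size. -/
theorem all_count {H : Type} [Fintype H] (S : Finset H) (k : ℕ) (hS : S.card = 2 * k) :
    Nat.card {M : H → H // MSet S M} * (2 ^ k * k.factorial) = (2 * k).factorial := by
  have h := matching_count (fun _ : H => (0 : Fin 1)) (S.card + 1) S (fun _ _ => k) (by omega)
    (fun _ _ => rfl) (by intro u; simp [ell, NN, hS, Subsingleton.elim u 0]; omega)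
  have e : (QQ (fun _ : H => (0 : Fin 1)) S (fun _ _ => k)).card
      = Nat.card {M : H → H // MSet S M} := by
    rw [Nat.card_eq_fintype_card, Fintype.card_subtype]
    congr 1
    ext M
    simp only [mem_QQ, Finset.mem_filter, Finset.mem_univ, true_and, and_iff_left_iff_imp]
    intro _ u v
    simp [cnt, NN, Subsingleton.elim u 0, Subsingleton.elim v 0, hS]; omega
  rw [e] at h
  have hD : DD (c := 1) (fun _ _ => k) = 2 ^ k * k.factorial := by
    have : (Finset.univ.filter (fun x : Fin 1 × Fin 1 => x.1 ≤ x.2)) = {(0, 0)} := by decide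
    simp [DD, this]
  rw [hD] at h
  rw [h]
  simp [ell, hS]

end Matching

section Paths

def GST {n : ℕ} {d : Fin n → ℕ} {k : ℕ} (E : Fin k → HE d × HE d) (j : ℕ) (a b : Fin n) : Prop :=
  Relation.ReflTransGen
    (fun x y => ∃ i : Fin k, i.val < j ∧
      (((E i).1.1 = x ∧ (E i).2.1 = y) ∨ ((E i).1.1 = y ∧ (E i).2.1 = x))) a b

def Good {n : ℕ} {d : Fin n → ℕ} {k : ℕ} (E : Fin k → HE d × HE d) (p : HE d × HE d) : Prop :=
  IsRootHE d p.1 ∧ IsNonRootHE d p.2 ∧ (∀ j, (E j).1 ≠ p.1) ∧ (∀ j, (E j).2 ≠ p.2) ∧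
    ¬ GST E k p.1.1 p.2.1

def Valid {n : ℕ} (d : Fin n → ℕ) (k : ℕ) (E : Fin k → HE d × HE d) : Prop :=
  ∀ j : Fin k, IsRootHE d (E j).1 ∧ IsNonRootHE d (E j).2 ∧
    (∀ i, i < j → (E i).1 ≠ (E j).1) ∧
    (∀ i, i < j → (E i).2 ≠ (E j).2) ∧
    ¬ GST E j.val (E j).1.1 (E j).2.1

lemma valid_iff {n : ℕ} (d : Fin n → ℕ) (E : Path d) : Valid d (n - 1) E ↔ IsExecPath d E :=
  Iff.rfl

lemma GST_snoc {n : ℕ} {d : Fin n → ℕ} {k : ℕ} (E : Fin k → HE d × HE d) (p : HE d × HE d)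
    (j : ℕ) (hj : j ≤ k) :
    GST (Fin.snoc (α := fun _ => HE d × HE d) E p) j = GST E j := by
  funext a b
  unfold GST
  congr 1
  funext x y
  apply propext
  constructor
  · rintro ⟨i, hi, h⟩
    refine ⟨⟨i.val, by omega⟩, hi, ?_⟩
    have : i = Fin.castSucc (⟨i.val, by omega⟩ : Fin k) := rfl
    rw [this, Fin.snoc_castSucc] at h
    exact h
  · rintro ⟨i, hi, h⟩
    refine ⟨i.castSucc, hi, ?_⟩
    rw [Fin.snoc_castSucc]
    exact h

lemma valid_snoc {n : ℕ} {d : Fin n → ℕ} {k : ℕ} (E : Fin k → HE d × HE d) (p : HE d × HE d) :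
    Valid d (k + 1) (Fin.snoc (α := fun _ => HE d × HE d) E p) ↔ Valid d k E ∧ Good E p := by
  unfold Valid
  rw [Fin.forall_fin_succ']
  apply and_congr
  · apply forall_congr'
    intro j
    simp only [Fin.forall_fin_succ', Fin.snoc_castSucc, Fin.snoc_last, Fin.castSucc_lt_castSucc_iff,
      Fin.val_castSucc]
    rw [GST_snoc E p _ (by omega)]
    have : ¬ (Fin.last k < j.castSucc) := by
      simp [Fin.le_last]
    simp [this]
  · simp only [Fin.forall_fin_succ', Fin.snoc_castSucc, Fin.snoc_last, Fin.castSucc_lt_last,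
      Fin.val_last]
    rw [GST_snoc E p _ le_rfl]
    simp [Good]

lemma root_ext {n : ℕ} {d : Fin n → ℕ} {h h' : HE d} (h1 : h.1 = h'.1)
    (h2 : h.2.val = h'.2.val) : h = h' := by
  obtain ⟨a, b⟩ := h
  obtain ⟨a', b'⟩ := h'
  simp only at h1
  subst h1
  congr 1
  exact Fin.ext h2

lemma root_eq {n : ℕ} {d : Fin n → ℕ} {h h' : HE d} (hr : IsRootHE d h) (hr' : IsRootHE d h')
    (h1 : h.1 = h'.1) : h = h' := by
  apply root_ext h1
  rw [hr, hr', h1]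

/-- each tree of the forest has exactly one unused root -/
lemma valid_inv {n : ℕ} {d : Fin n → ℕ} {k : ℕ} (E : Fin k → HE d × HE d) (hE : Valid d k E) :
    ∃ ρ : Fin n → Fin n, (∀ x y, GST E k x y ↔ ρ x = ρ y) ∧
      (∀ x j, (E j).1.1 ≠ ρ x) ∧ (∀ v, (∀ j, (E j).1.1 ≠ v) → ρ v = v) := by
  induction k with
  | zero =>
    refine ⟨id, ?_, fun x j => j.elim0, fun _ _ => rfl⟩
    intro x y
    constructor
    · intro h
      induction h with
      | refl => rfl
      | tail _ h _ => obtain ⟨i, _⟩ := h; exact i.elim0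
    · rintro rfl
      exact Relation.ReflTransGen.refl
  | succ k ih =>
    obtain ⟨E, p, rfl⟩ : ∃ E' p, E = Fin.snoc (α := fun _ => HE d × HE d) E' p :=
      ⟨Fin.init E, E (Fin.last k), (Fin.snoc_init_self E).symm⟩
    rw [valid_snoc] at hE
    obtain ⟨hV, g1, g2, g3, g4, g5⟩ := hE
    obtain ⟨ρ, h1, h2, h3⟩ := ih E hV
    set E' : Fin (k + 1) → HE d × HE d := Fin.snoc (α := fun _ => HE d × HE d) E p with hE'
    have hr : ρ p.1.1 = p.1.1 := by
      apply h3
      intro j hj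
      exact g3 j (root_eq (hV j).1 g1 hj)
    have hs : ρ p.2.1 ≠ p.1.1 := by
      intro h
      apply g5
      rw [h1, hr, h]
    have hmono : ∀ x y, GST E k x y → GST E' (k + 1) x y := by
      intro x y h
      refine Relation.ReflTransGen.mono ?_ x y h
      rintro a b ⟨i, hi, h⟩
      refine ⟨i.castSucc, by simp, ?_⟩
      rw [hE', Fin.snoc_castSucc]
      exact h
    have hsym : ∀ x y, GST E' (k + 1) x y → GST E' (k + 1) y x := by
      intro x y h
      unfold GST at h ⊢
      induction h with
      | refl => exact Relation.ReflTransGen.refl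
      | tail _ hbc ih =>
        obtain ⟨i, hi, h⟩ := hbc
        exact Relation.ReflTransGen.head ⟨i, hi, h.symm⟩ ih
    have hedge : GST E' (k + 1) p.1.1 p.2.1 := by
      apply Relation.ReflTransGen.single
      refine ⟨Fin.last k, by simp, ?_⟩
      rw [hE', Fin.snoc_last]
      exact Or.inl ⟨rfl, rfl⟩
    have hρρ : ∀ x, ρ (ρ x) = ρ x := fun x => h3 _ (fun j => h2 x j)
    set ρ' : Fin n → Fin n := fun x => if ρ x = p.1.1 then ρ p.2.1 else ρ x with hρ'
    have hto : ∀ x, GST E' (k + 1) x (ρ' x) := by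
      intro x
      by_cases hx : ρ x = p.1.1
      · simp only [hρ', hx, if_true]
        have a1 : GST E' (k + 1) x p.1.1 := hmono _ _ ((h1 _ _).2 (by rw [hr, hx]))
        have a2 : GST E' (k + 1) p.2.1 (ρ p.2.1) := hmono _ _ ((h1 _ _).2 (by rw [hρρ]))
        exact (a1.trans hedge).trans a2
      · simp only [hρ', hx, if_false]
        exact hmono _ _ ((h1 _ _).2 (by rw [hρρ]))
    refine ⟨ρ', ?_, ?_, ?_⟩
    · intro x y
      constructor
      · intro h
        induction h with
        | refl => rfl
        | @tail b c _ hbc ih =>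
          rw [ih]
          have hgen : ∀ i : Fin (k + 1), ρ' (E' i).1.1 = ρ' (E' i).2.1 := by
            intro i
            refine Fin.lastCases ?_ ?_ i
            · rw [hE', Fin.snoc_last]
              simp [hρ', hr, hs]
            · intro i
              rw [hE', Fin.snoc_castSucc]
              have : ρ (E i).1.1 = ρ (E i).2.1 :=
                (h1 _ _).1 (Relation.ReflTransGen.single ⟨i, i.2, Or.inl ⟨rfl, rfl⟩⟩)
              simp [hρ', this]
          obtain ⟨i, _, ⟨rfl, rfl⟩ | ⟨rfl, rfl⟩⟩ := hbc
          · exact hgen i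
          · exact (hgen i).symm
      · intro h
        exact (h ▸ hto x : GST E' (k + 1) x (ρ' y)).trans (hsym _ _ (hto y))
    · intro x j
      refine Fin.lastCases ?_ ?_ j
      · rw [hE', Fin.snoc_last]
        by_cases hx : ρ x = p.1.1
        · simp only [hρ', hx, if_true]; exact hs.symm
        · simp only [hρ', hx, if_false]; exact fun h => hx h.symm
      · intro j
        rw [hE', Fin.snoc_castSucc]
        by_cases hx : ρ x = p.1.1
        · simp only [hρ', hx, if_true]; exact h2 _ _
        · simp only [hρ', hx, if_false]; exact h2 _ _
    · intro v hv
      rw [Fin.forall_fin_succ'] at hv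
      simp only [hE', Fin.snoc_castSucc, Fin.snoc_last] at hv
      have hv' := h3 v hv.1
      have : ¬ (ρ v = p.1.1) := by rw [hv']; exact fun h => hv.2 h.symm
      show (if ρ v = p.1.1 then ρ p.2.1 else ρ v) = v
      rw [if_neg this, hv']

lemma inj_of_lt {k : ℕ} {α : Type} (f : Fin k → α) (h : ∀ j i, i < j → f i ≠ f j) :
    Function.Injective f := by
  intro a b hab
  rcases lt_trichotomy a b with h' | h' | h'
  · exact absurd hab (h _ _ h')
  · exact h'
  · exact absurd hab.symm (h _ _ h')

lemma valid_inj1 {n : ℕ} {d : Fin n → ℕ} {k : ℕ} {E : Fin k → HE d × HE d} (hE : Valid d k E) :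
    Function.Injective (fun j => (E j).1) :=
  inj_of_lt _ (fun j i h => (hE j).2.2.1 i h)

lemma valid_inj2 {n : ℕ} {d : Fin n → ℕ} {k : ℕ} {E : Fin k → HE d × HE d} (hE : Valid d k E) :
    Function.Injective (fun j => (E j).2) :=
  inj_of_lt _ (fun j i h => (hE j).2.2.2.1 i h)

def rootHE {n : ℕ} {d : Fin n → ℕ} (hd : ∀ i, 1 ≤ d i) (i : Fin n) : HE d :=
  ⟨i, ⟨d i - 1, by have := hd i; omega⟩⟩

lemma card_roots {n : ℕ} {d : Fin n → ℕ} (hd : ∀ i, 1 ≤ d i) :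
    (Finset.univ.filter (fun h : HE d => IsRootHE d h)).card = n := by
  have : Finset.univ.filter (fun h : HE d => IsRootHE d h)
      = Finset.univ.image (rootHE hd) := by
    ext h
    simp only [Finset.mem_filter, Finset.mem_univ, true_and, Finset.mem_image]
    constructor
    · intro hr
      exact ⟨h.1, root_eq rfl hr rfl⟩
    · rintro ⟨i, rfl⟩
      rfl
  rw [this, Finset.card_image_of_injective]
  · simp
  · intro a b h
    exact congrArg Sigma.fst h

lemma nonroot_iff {n : ℕ} {d : Fin n → ℕ} (h : HE d) :
    IsNonRootHE d h ↔ ¬ IsRootHE d h := by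
  have := h.2.2
  unfold IsNonRootHE IsRootHE
  omega

lemma card_nonroots {n : ℕ} {d : Fin n → ℕ} (hd : ∀ i, 1 ≤ d i) :
    (Finset.univ.filter (fun h : HE d => IsNonRootHE d h)).card = (∑ i, d i) - n := by
  have h1 := Finset.card_filter_add_card_filter_not (s := (Finset.univ : Finset (HE d)))
    (fun h : HE d => IsRootHE d h)
  rw [card_roots hd] at h1
  simp only [nonroot_iff]
  have : (Finset.univ : Finset (HE d)).card = ∑ i, d i := by
    rw [Finset.card_univ, Fintype.card_sigma]; simp
  omega

lemma card_good {n : ℕ} {d : Fin n → ℕ} (hd : ∀ i, 1 ≤ d i) {k : ℕ}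
    (E : Fin k → HE d × HE d) (hE : Valid d k E) :
    (Finset.univ.filter (fun p => Good E p)).card = (n - 1 - k) * ((∑ i, d i) - n - k) := by
  obtain ⟨ρ, h1, h2, h3⟩ := valid_inv E hE
  set R := (Finset.univ.filter (fun h : HE d => IsRootHE d h)) \
    Finset.univ.image (fun j => (E j).1) with hR
  set N := (Finset.univ.filter (fun h : HE d => IsNonRootHE d h)) \
    Finset.univ.image (fun j => (E j).2) with hN
  have cR : R.card = n - k := by
    rw [hR, Finset.card_sdiff_of_subset, card_roots hd,
      Finset.card_image_of_injective _ (valid_inj1 hE)]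
    · simp
    · intro x hx
      simp only [Finset.mem_image, Finset.mem_univ, true_and] at hx
      obtain ⟨j, rfl⟩ := hx
      simp [(hE j).1]
  have cN : N.card = (∑ i, d i) - n - k := by
    rw [hN, Finset.card_sdiff_of_subset, card_nonroots hd,
      Finset.card_image_of_injective _ (valid_inj2 hE)]
    · simp
    · intro x hx
      simp only [Finset.mem_image, Finset.mem_univ, true_and] at hx
      obtain ⟨j, rfl⟩ := hx
      simp [(hE j).2.1]
  have mR : ∀ r, r ∈ R ↔ IsRootHE d r ∧ ∀ j, (E j).1 ≠ r := by
    intro r; simp [hR]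
  have mN : ∀ s, s ∈ N ↔ IsNonRootHE d s ∧ ∀ j, (E j).2 ≠ s := by
    intro r; simp [hN]
  have rR : ∀ r ∈ R, ρ r.1 = r.1 := by
    intro r hr
    rw [mR] at hr
    apply h3
    intro j hj
    exact hr.2 j (root_eq (hE j).1 hr.1 hj)
  rw [Finset.card_eq_sum_card_fiberwise (f := Prod.snd) (t := N)]
  · rw [Finset.sum_congr rfl (g := fun _ => n - 1 - k)]
    · rw [Finset.sum_const, cN, smul_eq_mul, mul_comm]
    · intro s hs
      have hmem : rootHE hd (ρ s.1) ∈ R := by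
        rw [mR]
        refine ⟨rfl, fun j hj => h2 s.1 j ?_⟩
        rw [hj]; rfl
      have : (Finset.univ.filter (fun p => Good E p)).filter (fun p => p.2 = s)
          = (R.erase (rootHE hd (ρ s.1))).image (fun r => (r, s)) := by
        ext ⟨r, s'⟩
        simp only [Finset.mem_filter, Finset.mem_univ, true_and, Finset.mem_image,
          Finset.mem_erase, Prod.mk.injEq]
        constructor
        · rintro ⟨⟨g1, g2, g3, g4, g5⟩, rfl⟩
          refine ⟨r, ⟨?_, (mR r).2 ⟨g1, g3⟩⟩, rfl, rfl⟩
          rintro rfl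
          apply g5
          rw [h1, rR _ hmem]
          rfl
        · rintro ⟨r', ⟨hne, hr'⟩, rfl, rfl⟩
          refine ⟨⟨((mR _).1 hr').1, ((mN _).1 hs).1, ((mR _).1 hr').2, ((mN _).1 hs).2, ?_⟩, rfl⟩
          rw [h1]
          simp only
          rw [rR _ hr']
          intro h
          exact hne (root_eq ((mR _).1 hr').1 rfl h)
      rw [this, Finset.card_image_of_injective, Finset.card_erase_of_mem hmem, cR]
      · omega
      · intro a b h; exact congrArg Prod.fst h
  · intro p hp
    simp only [Finset.coe_filter, Finset.mem_univ, true_and, Set.mem_ofPred_eq] at hp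
    exact Finset.mem_coe.2 ((mN _).2 ⟨hp.2.1, hp.2.2.2.1⟩)

lemma card_valid {n : ℕ} {d : Fin n → ℕ} (hd : ∀ i, 1 ≤ d i) (k : ℕ) :
    (Finset.univ.filter (fun E => Valid d k E)).card
      = ∏ j ∈ Finset.range k, ((n - 1 - j) * ((∑ i, d i) - n - j)) := by
  induction k with
  | zero =>
    have : Finset.univ.filter (fun E => Valid d 0 E) = Finset.univ := by
      rw [Finset.filter_true_of_mem]
      intro E _ j
      exact j.elim0
    rw [this]; simp
  | succ k ih =>
    rw [Finset.prod_range_succ, ← ih,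
      Finset.card_eq_sum_card_fiberwise (f := fun E => Fin.init E)
        (t := Finset.univ.filter (fun E => Valid d k E))]
    · rw [Finset.sum_congr rfl (g := fun _ => (n - 1 - k) * ((∑ i, d i) - n - k)),
        Finset.sum_const, smul_eq_mul]
      intro E hE
      simp only [Finset.mem_filter, Finset.mem_univ, true_and] at hE
      rw [← card_good hd E hE]
      have : (Finset.univ.filter (fun E' => Valid d (k + 1) E')).filter (fun E' => Fin.init E' = E)
          = (Finset.univ.filter (fun p => Good E p)).image
            (fun p => Fin.snoc (α := fun _ => HE d × HE d) E p) := by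
        ext E'
        simp only [Finset.mem_filter, Finset.mem_univ, true_and, Finset.mem_image]
        constructor
        · rintro ⟨hV, rfl⟩
          refine ⟨E' (Fin.last k), ?_, Fin.snoc_init_self E'⟩
          rw [← Fin.snoc_init_self E', valid_snoc] at hV
          exact hV.2
        · rintro ⟨p, hp, rfl⟩
          exact ⟨(valid_snoc E p).2 ⟨hE, hp⟩, Fin.init_snoc _ _⟩
      rw [this, Finset.card_image_of_injective]
      intro a b h
      have := congrFun h (Fin.last k)
      simpa using this
    · intro E hE
      simp only [Finset.coe_filter, Finset.mem_univ, true_and, Set.mem_ofPred_eq] at hE ⊢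
      rw [← Fin.snoc_init_self E, valid_snoc] at hE
      exact hE.1

theorem card_exec {n : ℕ} {d : Fin n → ℕ} (hd : ∀ i, 1 ≤ d i) :
    Nat.card {E : Path d // IsExecPath d E}
      = (n - 1).factorial * ((∑ i, d i) - n).descFactorial (n - 1) := by
  rw [Nat.card_eq_fintype_card, Fintype.card_subtype]
  have := card_valid hd (n - 1)
  rw [Finset.prod_mul_distrib, ← Nat.descFactorial_eq_prod_range,
    ← Nat.descFactorial_eq_prod_range, Nat.descFactorial_self] at this
  exact this

/-- unused half-edges -/
noncomputable def Sun {n : ℕ} {d : Fin n → ℕ} (E : Path d) : Finset (HE d) :=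
  Finset.univ.filter (fun h => ¬ UsedIn E h)

lemma ell_unused {n : ℕ} {d : Fin n → ℕ} (E : Path d) (hE : IsExecPath d E) (i : Fin n) :
    ell (fun h : HE d => h.1) (Sun E) i
      + (Finset.univ.filter (fun k => (E k).1.1 = i)).card
      + (Finset.univ.filter (fun k => (E k).2.1 = i)).card = d i := by
  have hV : Valid d (n - 1) E := hE
  set A := (Sun E).filter (fun h => h.1 = i)
  set B := (Finset.univ.filter (fun k => (E k).1.1 = i)).image (fun k => (E k).1) with hB
  set C := (Finset.univ.filter (fun k => (E k).2.1 = i)).image (fun k => (E k).2) with hC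
  have cB : B.card = (Finset.univ.filter (fun k => (E k).1.1 = i)).card :=
    Finset.card_image_of_injective _ (valid_inj1 hV)
  have cC : C.card = (Finset.univ.filter (fun k => (E k).2.1 = i)).card :=
    Finset.card_image_of_injective _ (valid_inj2 hV)
  have dBC : Disjoint B C := by
    rw [Finset.disjoint_left]
    intro x hx hx'
    simp only [hB, hC, Finset.mem_image, Finset.mem_filter, Finset.mem_univ, true_and] at hx hx'
    obtain ⟨k, _, rfl⟩ := hx
    obtain ⟨l, _, hl⟩ := hx'
    exact (nonroot_iff _).1 (hE l).2.1 (hl ▸ (hE k).1)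
  have dA : Disjoint A (B ∪ C) := by
    rw [Finset.disjoint_left]
    intro x hx hx'
    simp only [A, Sun, Finset.mem_filter, Finset.mem_univ, true_and] at hx
    simp only [hB, hC, Finset.mem_union, Finset.mem_image, Finset.mem_filter, Finset.mem_univ,
      true_and] at hx'
    apply hx.1
    rcases hx' with ⟨k, _, h⟩ | ⟨k, _, h⟩
    · exact Or.inl ⟨k, h⟩
    · exact Or.inr ⟨k, h⟩
  have hU : A ∪ (B ∪ C) = Finset.univ.image (fun j : Fin (d i) => (⟨i, j⟩ : HE d)) := by
    ext x
    simp only [A, hB, hC, Sun, Finset.mem_union, Finset.mem_image, Finset.mem_filter,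
      Finset.mem_univ, true_and]
    constructor
    · have : x.1 = i → ∃ a, (⟨i, a⟩ : HE d) = x := by
        rintro rfl; exact ⟨x.2, rfl⟩
      rintro (⟨_, h⟩ | ⟨k, h, rfl⟩ | ⟨k, h, rfl⟩) <;> exact this h
    · rintro ⟨j, rfl⟩
      by_cases hu : UsedIn E (⟨i, j⟩ : HE d)
      · right
        rcases hu with ⟨k, hk⟩ | ⟨k, hk⟩
        · left; exact ⟨k, by rw [hk], hk⟩
        · right; exact ⟨k, by rw [hk], hk⟩
      · left; exact ⟨hu, rfl⟩
  have hc : (A ∪ (B ∪ C)).card = d i := by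
    rw [hU, Finset.card_image_of_injective]
    · simp
    · intro a b h
      simpa using h
  rw [Finset.card_union_of_disjoint dA, Finset.card_union_of_disjoint dBC, cB, cC] at hc
  show A.card + _ + _ = _
  omega

lemma card_Sun {n : ℕ} {d : Fin n → ℕ} (E : Path d) (hE : IsExecPath d E) :
    (Sun E).card + 2 * (n - 1) = ∑ i, d i := by
  rw [← Finset.sum_congr rfl (fun i _ => ell_unused E hE i), Finset.sum_add_distrib,
    Finset.sum_add_distrib]
  unfold ell
  rw [← Finset.card_eq_sum_card_fiberwise (fun _ _ => by simp),
    ← Finset.card_eq_sum_card_fiberwise (fun _ _ => by simp),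
    ← Finset.card_eq_sum_card_fiberwise (fun _ _ => by simp)]
  simp; ring

lemma completion_iff {n : ℕ} {d : Fin n → ℕ} (E : Path d) (M : HE d → HE d) :
    IsCompletion E M ↔ MSet (Sun E) M := by
  simp [IsCompletion, MSet, Sun]

lemma matchCount_eq {n : ℕ} {d : Fin n → ℕ} (E : Path d) (M : HE d → HE d) (u v : Fin n) :
    matchCount E M u v = cnt (fun h : HE d => h.1) (Sun E) M u v := by
  unfold matchCount cnt Sun
  rw [Nat.card_eq_fintype_card, Fintype.card_subtype, Finset.filter_filter]

end Paths

section Trees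

lemma no_cycle {n : ℕ} {root : Fin n} {par : Fin n → Fin n} (ht : IsRootedTree root par)
    (v : Fin n) (hv : v ≠ root) (m : ℕ) : par^[m] (par v) ≠ v := by
  intro h
  have hp : Function.IsPeriodicPt par (m + 1) v := by
    show par^[m + 1] v = v
    rw [Function.iterate_succ_apply]; exact h
  obtain ⟨p, hp'⟩ := ht.2 v
  have hroot : ∀ j, par^[j] root = root := fun j => Function.iterate_fixed ht.1 j
  have h1 : par^[(m + 1) * p] v = v := hp.mul_const p
  have h2 : (m + 1) * p = m * p + p := by ring
  rw [h2, Function.iterate_add_apply, hp', hroot] at h1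
  exact hv h1.symm

lemma par_ne {n : ℕ} {root : Fin n} {par : Fin n → Fin n} (ht : IsRootedTree root par)
    (v : Fin n) (hv : v ≠ root) : par v ≠ v := no_cycle ht v hv 0

lemma tree_exec {n : ℕ} {d : Fin n → ℕ} {root : Fin n} {par : Fin n → Fin n}
    (ht : IsRootedTree root par) (E : Path d)
    (h1 : ∀ k, IsRootHE d (E k).1) (h2 : ∀ k, IsNonRootHE d (E k).2)
    (h3 : Function.Injective (fun k => (E k).1.1)) (h4 : Function.Injective (fun k => (E k).2))
    (h5 : ∀ k, (E k).1.1 ≠ root) (h6 : ∀ k, par (E k).1.1 = (E k).2.1) : IsExecPath d E := by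
  intro k
  refine ⟨h1 k, h2 k, ?_, ?_, ?_⟩
  · intro j hj h
    exact hj.ne (h3 (congrArg Sigma.fst h))
  · intro j hj h
    exact hj.ne (h4 h)
  · intro hst
    have key : ∀ v, v ≠ (E k).1.1 → ((∃ m, par^[m] v = (E k).1.1) ↔
        ∃ m, par^[m] (par v) = (E k).1.1) := by
      intro v hv
      constructor
      · rintro ⟨m, hm⟩
        cases m with
        | zero => exact absurd hm hv
        | succ m => exact ⟨m, hm⟩
      · rintro ⟨m, hm⟩
        exact ⟨m + 1, hm⟩
    have : ∀ b, SameTree E k (E k).1.1 b → ∃ m, par^[m] b = (E k).1.1 := by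
      intro b hb
      unfold SameTree at hb
      induction hb with
      | refl => exact ⟨0, rfl⟩
      | tail _ hbc ih =>
        obtain ⟨j, hj, ⟨rfl, rfl⟩ | ⟨rfl, rfl⟩⟩ := hbc
        · rw [← h6]
          exact (key _ (fun h => hj.ne (h3 h))).1 ih
        · rw [← h6] at ih
          exact (key _ (fun h => hj.ne (h3 h))).2 ih
    obtain ⟨m, hm⟩ := this _ hst
    rw [← h6] at hm
    exact no_cycle ht _ (h5 k) m hm

lemma exec_vinj {n : ℕ} {d : Fin n → ℕ} {E : Path d} (hE : IsExecPath d E) :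
    Function.Injective (fun k => (E k).1.1) := by
  intro a b hab
  exact valid_inj1 (k := n - 1) hE (root_eq (hE a).1 (hE b).1 hab)

lemma exec_ne_root {n : ℕ} (hn : 1 ≤ n) {d : Fin n → ℕ} {E : Path d} {root : Fin n}
    {par : Fin n → Fin n} (hE : IsExecPath d E) (hT : TreeEq E root par) (k : Fin (n - 1)) :
    (E k).1.1 ≠ root := by
  intro hk
  have hs : Function.Surjective (fun k => (E k).1.1) := by
    intro v
    by_cases hv : v = root
    · exact ⟨k, by simp [hk, hv]⟩
    · exact hT.2 v hv
  have := Fintype.card_le_of_surjective _ hs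
  simp at this
  omega

theorem card_tree {n : ℕ} (hn : 1 ≤ n) {d : Fin n → ℕ} (hd : ∀ i, 1 ≤ d i) {root : Fin n}
    {par : Fin n → Fin n} (ht : IsRootedTree root par) :
    Nat.card {E : Path d // IsExecPath d E ∧ TreeEq E root par}
      = (n - 1).factorial * ∏ i, (d i - 1).descFactorial (childCount root par i) := by
  have hcard : Fintype.card {v : Fin n // v ≠ root} = n - 1 := by
    rw [Fintype.card_subtype_compl]; simp
  have c1 : Nat.card (Fin (n - 1) ≃ {v : Fin n // v ≠ root}) = (n - 1).factorial := by
    rw [Nat.card_eq_fintype_card, Fintype.card_equiv (Fintype.equivOfCardEq (by rw [hcard]; simp))]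
    simp
  have c2 : Nat.card (∀ i, {v : Fin n // v ≠ root ∧ par v = i} ↪ Fin (d i - 1))
      = ∏ i, (d i - 1).descFactorial (childCount root par i) := by
    rw [Nat.card_pi]
    apply Finset.prod_congr rfl
    intro i _
    rw [Nat.card_eq_fintype_card, Fintype.card_embedding_eq, childCount,
      Nat.card_eq_fintype_card, Fintype.card_fin]
  rw [← c1, ← c2, ← Nat.card_prod]
  symm
  let F : (Fin (n - 1) ≃ {v : Fin n // v ≠ root}) ×
      (∀ i, {v : Fin n // v ≠ root ∧ par v = i} ↪ Fin (d i - 1)) → Path d :=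
    fun x k => (rootHE hd (x.1 k).1,
      ⟨par (x.1 k).1, Fin.castLE (Nat.sub_le _ _) (x.2 (par (x.1 k).1) ⟨(x.1 k).1, (x.1 k).2, rfl⟩)⟩)
  have hF : ∀ x, IsExecPath d (F x) ∧ TreeEq (F x) root par := by
    intro x
    constructor
    · apply tree_exec ht
      · intro k; rfl
      · intro k
        exact (x.2 (par (x.1 k).1) ⟨(x.1 k).1, (x.1 k).2, rfl⟩).2
      · intro a b hab
        exact x.1.injective (Subtype.ext hab)
      · have gen : ∀ i j (vi : {v : Fin n // v ≠ root ∧ par v = i})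
            (vj : {v : Fin n // v ≠ root ∧ par v = j}), i = j →
            (x.2 i vi).val = (x.2 j vj).val → vi.1 = vj.1 := by
          intro i j vi vj hij hv
          subst hij
          exact congrArg Subtype.val ((x.2 i).injective (Fin.ext hv))
        intro a b hab
        apply x.1.injective
        apply Subtype.ext
        have e1 : par (x.1 a).1 = par (x.1 b).1 := congrArg Sigma.fst hab
        have e2 : ((F x a).2.2).val = ((F x b).2.2).val :=
          congrArg (fun h : HE d => h.2.val) hab
        exact gen _ _ ⟨(x.1 a).1, (x.1 a).2, rfl⟩ ⟨(x.1 b).1, (x.1 b).2, rfl⟩ e1 e2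
      · intro k; exact (x.1 k).2
      · intro k; rfl
    · refine ⟨fun k => rfl, fun v hv => ⟨x.1.symm ⟨v, hv⟩, ?_⟩⟩
      show (x.1 (x.1.symm ⟨v, hv⟩)).1 = v
      simp
  apply Nat.card_congr
  refine Equiv.ofBijective (fun x => ⟨F x, hF x⟩) ⟨?_, ?_⟩
  · rintro ⟨e, f⟩ ⟨e', f'⟩ h
    have h' : F (e, f) = F (e', f') := congrArg Subtype.val h
    have he : e = e' := by
      ext k
      have := congrArg (fun p : HE d × HE d => p.1.1) (congrFun h' k)
      exact congrArg Fin.val this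
    subst he
    have hf : f = f' := by
      funext i
      ext ⟨v, hv, hi⟩
      subst hi
      obtain ⟨k, hk⟩ := e.surjective ⟨v, hv⟩
      have := congrArg (fun p : HE d × HE d => p.2.2.val) (congrFun h' k)
      simp only [F, Fin.val_castLE] at this
      have hk' : v = (e k).1 := by rw [hk]
      subst hk'
      exact this
    rw [hf]
  · rintro ⟨E, hE, hT⟩
    have hbij : Function.Bijective
        (fun k => (⟨(E k).1.1, exec_ne_root hn hE hT k⟩ : {v : Fin n // v ≠ root})) := by
      constructor
      · intro a b hab
        exact exec_vinj hE (congrArg Subtype.val hab)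
      · rintro ⟨v, hv⟩
        obtain ⟨k, hk⟩ := hT.2 v hv
        exact ⟨k, Subtype.ext hk⟩
    let e := Equiv.ofBijective _ hbij
    have he : ∀ v : {v : Fin n // v ≠ root}, (E (e.symm v)).1.1 = v.1 := by
      intro v
      exact congrArg Subtype.val (e.apply_symm_apply v)
    have he2 : ∀ i (v : {v : Fin n // v ≠ root ∧ par v = i}),
        (E (e.symm ⟨v.1, v.2.1⟩)).2.1 = i := by
      intro i v
      rw [← hT.1, he]
      exact v.2.2
    have hlt : ∀ i (v : {v : Fin n // v ≠ root ∧ par v = i}),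
        (E (e.symm ⟨v.1, v.2.1⟩)).2.2.val < d i - 1 := by
      intro i v
      have := (hE (e.symm ⟨v.1, v.2.1⟩)).2.1
      unfold IsNonRootHE at this
      exact lt_of_lt_of_eq this (by rw [he2])
    let f : ∀ i, {v : Fin n // v ≠ root ∧ par v = i} ↪ Fin (d i - 1) := fun i =>
      ⟨fun v => ⟨(E (e.symm ⟨v.1, v.2.1⟩)).2.2.val, hlt i v⟩, by
        intro v w hvw
        have h0 := congrArg Fin.val hvw
        have h1 : (E (e.symm ⟨v.1, v.2.1⟩)).2 = (E (e.symm ⟨w.1, w.2.1⟩)).2 := by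
          apply root_ext
          · rw [he2, he2]
          · exact h0
        have h2 := e.symm.injective (valid_inj2 (k := n - 1) hE h1)
        exact Subtype.ext (congrArg (fun z : {v : Fin n // v ≠ root} => z.1) h2)⟩
    refine ⟨(e, f), ?_⟩
    apply Subtype.ext
    funext k
    apply Prod.ext
    · exact root_eq rfl (hE k).1 rfl
    · apply root_ext
      · exact hT.1 k
      · show (E (e.symm (e k))).2.2.val = _
        rw [Equiv.symm_apply_apply]

lemma card_fiber {A B : Type} [Fintype A] [Fintype B] (P : A → Prop) (R : A → B → Prop) (a b : ℕ)
    (h : ∀ x, P x → Nat.card {y // R x y} * a = b) :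
    Nat.card {x : A × B // P x.1 ∧ R x.1 x.2} * a = Nat.card {x // P x} * b := by
  have e : {x : A × B // P x.1 ∧ R x.1 x.2} ≃ Σ x : {x // P x}, {y // R x.1 y} :=
    { toFun := fun x => ⟨⟨x.1.1, x.2.1⟩, ⟨x.1.2, x.2.2⟩⟩
      invFun := fun x => ⟨(x.1.1, x.2.1), x.1.2, x.2.2⟩
      left_inv := fun _ => rfl
      right_inv := fun _ => rfl }
  rw [Nat.card_congr e, Nat.card_sigma, Finset.sum_mul,
    Finset.sum_congr rfl (fun x _ => h x.1 x.2), Finset.sum_const, smul_eq_mul,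
    Finset.card_univ, Nat.card_eq_fintype_card]

theorem card_total {n : ℕ} (hn : 1 ≤ n) {d : Fin n → ℕ} (hd : ∀ i, 1 ≤ d i)
    (heven : Even (∑ i, d i)) (hsum : 2 * n ≤ ∑ i, d i) :
    Nat.card {x : Path d × (HE d → HE d) // IsExecPath d x.1 ∧ IsCompletion x.1 x.2}
      * (2 ^ ((∑ i, d i) / 2 - n) * ((∑ i, d i) / 2 - n).factorial)
      = (n - 1).factorial * ((∑ i, d i) - n).factorial := by
  obtain ⟨m, hm⟩ := heven
  set s := ∑ i, d i with hs
  obtain ⟨j, hj⟩ : ∃ j, m = n + j := ⟨m - n, by omega⟩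
  have hj' : s / 2 - n = j := by omega
  rw [hj']
  have h := card_fiber (IsExecPath d) (fun E M => IsCompletion E M)
    (2 ^ (j + 1) * (j + 1).factorial) (2 * (j + 1)).factorial (by
      intro E hE
      have h1 := card_Sun E hE
      simp only [completion_iff]
      exact all_count (Sun E) (j + 1) (by omega))
  rw [card_exec hd, ← hs] at h
  have h2 := Nat.factorial_mul_descFactorial (n := s - n) (k := n - 1) (by omega)
  have h3 : s - n - (n - 1) = 2 * j + 1 := by omega
  rw [h3] at h2
  have h4 : (2 * (j + 1)).factorial = 2 * (j + 1) * (2 * j + 1).factorial := by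
    rw [show 2 * (j + 1) = (2 * j + 1) + 1 by ring, Nat.factorial_succ]
  apply Nat.eq_of_mul_eq_mul_right (show 0 < 2 * (j + 1) by omega)
  rw [← h2]
  rw [h4, Nat.factorial_succ, pow_succ] at h
  linarith

lemma treeEdge_le {n : ℕ} {root : Fin n} {par : Fin n → Fin n} (ht : IsRootedTree root par)
    (g : Fin n → Fin n → ℕ) (hgsym : ∀ u v, g u v = g v u)
    (hspan : ∀ v, v ≠ root → 1 ≤ g v (par v)) (u v : Fin n) :
    treeEdgeNum root par u v ≤ g u v := by
  unfold treeEdgeNum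
  by_cases h1 : u ≠ root ∧ par u = v
  · have h2 : ¬ (v ≠ root ∧ par v = u) := by
      rintro ⟨_, h⟩
      apply no_cycle ht u h1.1 1
      rw [h1.2]; exact h
    have := hspan u h1.1
    rw [h1.2] at this
    simp only [if_pos h1, if_neg h2]
    omega
  · by_cases h2 : v ≠ root ∧ par v = u
    · have := hspan v h2.1
      rw [h2.2, hgsym] at this
      simp only [if_neg h1, if_pos h2]
      omega
    · simp [h1, h2]

lemma treeEdge_self {n : ℕ} {root : Fin n} {par : Fin n → Fin n} (ht : IsRootedTree root par)
    (u : Fin n) : treeEdgeNum root par u u = 0 := by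
  have : ¬ (u ≠ root ∧ par u = u) := fun h => par_ne ht u h.1 h.2
  simp [treeEdgeNum, this]

lemma mult_add {n : ℕ} {root : Fin n} {par : Fin n → Fin n} (ht : IsRootedTree root par)
    (g : Fin n → Fin n → ℕ) (hgsym : ∀ u v, g u v = g v u)
    (hspan : ∀ v, v ≠ root → 1 ≤ g v (par v)) (u v : Fin n) :
    multMinusTree g root par u v + treeEdgeNum root par u v = g u v := by
  unfold multMinusTree
  by_cases h : u = v
  · subst h; simp [treeEdge_self ht]
  · have := treeEdge_le ht g hgsym hspan u v
    simp only [h, if_false]; omega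

lemma sum_treeEdge {n : ℕ} {root : Fin n} {par : Fin n → Fin n} (u : Fin n) :
    ∑ v, treeEdgeNum root par u v = (if u ≠ root then 1 else 0) + childCount root par u := by
  unfold treeEdgeNum childCount
  rw [Finset.sum_add_distrib, Nat.card_eq_fintype_card, Fintype.card_subtype, Finset.card_filter]
  congr 1
  by_cases h : u = root <;> simp [h]

lemma exec_counts {n : ℕ} (hn : 1 ≤ n) {d : Fin n → ℕ} {E : Path d} {root : Fin n}
    {par : Fin n → Fin n} (hE : IsExecPath d E) (hT : TreeEq E root par) (u : Fin n) :
    ell (fun h : HE d => h.1) (Sun E) u + (if u ≠ root then 1 else 0) + childCount root par u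
      = d u := by
  have h := ell_unused E hE u
  have h1 : (Finset.univ.filter (fun k => (E k).1.1 = u)).card = if u ≠ root then 1 else 0 := by
    by_cases hu : u = root
    · subst hu
      simp only [ne_eq, not_true_eq_false, if_false, Finset.card_eq_zero]
      rw [Finset.filter_eq_empty_iff]
      intro k _
      exact exec_ne_root hn hE hT k
    · simp only [ne_eq, hu, not_false_eq_true, if_true]
      obtain ⟨k, hk⟩ := hT.2 u hu
      rw [Finset.card_eq_one]
      refine ⟨k, ?_⟩
      ext j
      simp only [Finset.mem_filter, Finset.mem_univ, true_and, Finset.mem_singleton]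
      constructor
      · intro hj
        exact exec_vinj hE (hj.trans hk.symm)
      · rintro rfl; exact hk
  have h2 : (Finset.univ.filter (fun k => (E k).2.1 = u)).card = childCount root par u := by
    unfold childCount
    rw [Nat.card_eq_fintype_card, Fintype.card_subtype]
    apply Finset.card_bij (fun k _ => (E k).1.1)
    · intro k hk
      simp only [Finset.mem_filter, Finset.mem_univ, true_and] at hk ⊢
      exact ⟨exec_ne_root hn hE hT k, by rw [hT.1, hk]⟩
    · intro a _ b _ hab
      exact exec_vinj hE hab
    · intro v hv
      simp only [Finset.mem_filter, Finset.mem_univ, true_and] at hv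
      obtain ⟨k, hk⟩ := hT.2 v hv.1
      refine ⟨k, ?_, hk⟩
      simp only [Finset.mem_filter, Finset.mem_univ, true_and]
      rw [← hT.1, hk, hv.2]
  rw [h1, h2] at h
  exact h

theorem card_num {n : ℕ} (hn : 1 ≤ n) {d : Fin n → ℕ}
    (hd : ∀ i, 1 ≤ d i)
    (g : Fin n → Fin n → ℕ) (hgsym : ∀ u v, g u v = g v u)
    (hgdeg : ∀ i, (∑ j, g i j) + g i i = d i)
    (root : Fin n) (par : Fin n → Fin n) (ht : IsRootedTree root par)
    (hspan : ∀ v, v ≠ root → 1 ≤ g v (par v))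
    (q : Fin n) (hγ : 1 ≤ multMinusTree g root par q root) :
    Nat.card {x : Path d × (HE d → HE d) //
          (IsExecPath d x.1 ∧ IsCompletion x.1 x.2) ∧
          TreeEq x.1 root par ∧ GraphEq x.1 x.2 g root par ∧
          (x.2 (rootHE hd root)).1 = q} * DD (multMinusTree g root par)
      = (n - 1).factorial * (∏ i, (d i - 1).factorial)
        * NN (multMinusTree g root par) root q := by
  set m := multMinusTree g root par with hm
  have madd := mult_add ht g hgsym hspan
  rw [← hm] at madd
  have tsym : ∀ u v, treeEdgeNum root par u v = treeEdgeNum root par v u := by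
    intro u v; unfold treeEdgeNum; rw [add_comm]
  have msym : ∀ u v, m u v = m v u := by
    intro u v
    have h1 := madd u v
    have h2 := madd v u
    rw [tsym, hgsym] at h1
    omega
  have mdiag : ∀ u, m u u = g u u := by
    intro u; simp [hm, multMinusTree]
  -- residual degrees
  set L : Fin n → ℕ := fun u => ∑ v, NN m u v with hL
  have sumNN : ∀ u, L u = (∑ v, m u v) + m u u := by
    intro u
    simp [hL, NN, Finset.sum_add_distrib]
  have Ldeg : ∀ u, L u + (if u ≠ root then 1 else 0) + childCount root par u = d u := by
    intro u
    have h1 : (∑ v, m u v) + ∑ v, treeEdgeNum root par u v = ∑ v, g u v := by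
      rw [← Finset.sum_add_distrib]
      exact Finset.sum_congr rfl (fun v _ => madd u v)
    rw [sum_treeEdge] at h1
    have h2 := hgdeg u
    have h3 := sumNN u
    have h4 := mdiag u
    omega
  have Lpos : 0 < L root := by
    rw [sumNN]
    have : m root q ≤ ∑ v, m root v :=
      Finset.single_le_sum (f := fun v => m root v) (fun _ _ => Nat.zero_le _) (Finset.mem_univ q)
    have := msym root q
    omega
  have cardeq : Nat.card {x : Path d × (HE d → HE d) //
          (IsExecPath d x.1 ∧ IsCompletion x.1 x.2) ∧
          TreeEq x.1 root par ∧ GraphEq x.1 x.2 g root par ∧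
          (x.2 (rootHE hd root)).1 = q}
      = Nat.card {x : Path d × (HE d → HE d) //
          (IsExecPath d x.1 ∧ TreeEq x.1 root par) ∧
          (IsCompletion x.1 x.2 ∧ GraphEq x.1 x.2 g root par ∧
          (x.2 (rootHE hd root)).1 = q)} := by
    apply Nat.card_congr
    apply Equiv.subtypeEquivRight
    intro x
    tauto
  have hfib := card_fiber (fun E : Path d => IsExecPath d E ∧ TreeEq E root par)
    (fun E M => IsCompletion E M ∧ GraphEq E M g root par ∧ (M (rootHE hd root)).1 = q)
    (DD m * L root) (NN m root q * ∏ u, (L u).factorial) (by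
      rintro E ⟨hE, hT⟩
      have hell : ∀ u, ell (fun h : HE d => h.1) (Sun E) u = L u := by
        intro u
        have h1 := exec_counts hn hE hT u
        have h2 := Ldeg u
        omega
      have hmem : rootHE hd root ∈ Sun E := by
        simp only [Sun, Finset.mem_filter, Finset.mem_univ, true_and]
        rintro (⟨k, hk⟩ | ⟨k, hk⟩)
        · apply exec_ne_root hn hE hT k
          rw [hk]; rfl
        · apply (nonroot_iff _).1 (hE k).2.1
          rw [hk]; rfl
      have hr := rooted_count (fun h : HE d => h.1) (Sun E) m msym hell (rootHE hd root) hmem q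
      have hc : Nat.card {M : HE d → HE d // IsCompletion E M ∧ GraphEq E M g root par ∧
          (M (rootHE hd root)).1 = q}
          = ((QQ (fun h : HE d => h.1) (Sun E) m).filter
            (fun M => (M (rootHE hd root)).1 = q)).card := by
        rw [Nat.card_eq_fintype_card, Fintype.card_subtype]
        congr 1
        ext M
        simp only [Finset.mem_filter, Finset.mem_univ, true_and, mem_QQ]
        rw [completion_iff, ← and_assoc]
        refine and_congr_left' (and_congr_right' ?_)
        unfold GraphEq
        simp only [matchCount_eq]
        constructor
        · rintro ⟨h1, h2⟩ u v
          by_cases huv : u = v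
          · subst huv
            rw [h2, NN, ← mdiag]; simp; omega
          · have := h1 u v huv
            have := madd u v
            simp only [NN, huv, if_false]
            omega
        · intro h
          constructor
          · intro u v huv
            have := madd u v
            rw [h]
            simp only [NN, huv, if_false]
            omega
          · intro u
            rw [h, NN, ← mdiag]; simp; omega
      rw [hc, ← mul_assoc]
      simp only [hell] at hr
      exact hr)
  rw [cardeq]
  rw [card_tree hn hd ht] at hfib
  have hprod : ∏ u, (L u).factorial
      = (∏ u, (d u - 1 - childCount root par u).factorial) * L root := by
    apply prod_pull _ root (Finset.mem_univ _)
    · intro x _ hx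
      have := Ldeg x
      simp only [ne_eq, hx, not_false_eq_true, if_true] at this
      congr 1
      omega
    · have := Ldeg root
      simp only [ne_eq, not_true_eq_false, if_false] at this
      obtain ⟨l, hl⟩ : ∃ l, L root = l + 1 := ⟨L root - 1, by omega⟩
      have : d root - 1 - childCount root par root = l := by omega
      rw [this, hl, Nat.factorial_succ]; ring
  have hprod2 : (∏ i, (d i - 1).descFactorial (childCount root par i))
      * (∏ u, (d u - 1 - childCount root par u).factorial) = ∏ i, (d i - 1).factorial := by
    rw [← Finset.prod_mul_distrib]
    apply Finset.prod_congr rfl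
    intro i _
    rw [mul_comm]
    apply Nat.factorial_mul_descFactorial
    have := Ldeg i
    by_cases hi : i = root
    · subst hi; omega
    · simp only [ne_eq, hi, not_false_eq_true, if_true] at this; omega
  apply Nat.eq_of_mul_eq_mul_right Lpos
  rw [mul_assoc, hfib, hprod, ← hprod2]
  ring

end Trees

/-- The law of the random tree-rooted graph `(G(d), T(d), Γ(d))` with degree sequence
`d`: for a multigraph `g` on `[n]` with degree sequence `d` (given by its symmetric
multiplicity function, loops counted via `g u u`), a spanning tree `t = (root, par)` of
`g`, and an oriented edge `γ` of `g - t` with head `root` and tail `q`,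
`P((G(d),T(d),Γ(d)) = (g,t,γ))
  = (∏ i, (d i - 1)!) ⋅ (2^{m-n} (m-n)! / (2m-n)!)
      ⋅ 2^{[γ loop]} m_{g-t}(γ) / (∏ i 2^{m_{g-t}(ii)} ⋅ ∏_{e} m_{g-t}(e)!)`.
The underlying probability space is the uniform distribution on pairs `(E, M)` of an
execution path and a completing perfect matching of the leftover half-edges. -/
theorem tree_rooted_graph_law (n : ℕ) (hn : 1 ≤ n) (d : Fin n → ℕ)
    (hd : ∀ i, 1 ≤ d i) (heven : Even (∑ i, d i)) (hsum : 2 * n ≤ ∑ i, d i)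
    (g : Fin n → Fin n → ℕ) (hgsym : ∀ u v, g u v = g v u)
    (hgdeg : ∀ i, (∑ j, g i j) + g i i = d i)
    (root : Fin n) (par : Fin n → Fin n) (ht : IsRootedTree root par)
    (hspan : ∀ v, v ≠ root → 1 ≤ g v (par v))
    (q : Fin n) (hγ : 1 ≤ multMinusTree g root par q root) :
    (Nat.card {x : Path d × (HE d → HE d) //
          (IsExecPath d x.1 ∧ IsCompletion x.1 x.2) ∧
          TreeEq x.1 root par ∧ GraphEq x.1 x.2 g root par ∧
          (x.2 ⟨root, ⟨d root - 1, by have := hd root; omega⟩⟩).1 = q} : ℝ)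
        / (Nat.card {x : Path d × (HE d → HE d) //
            IsExecPath d x.1 ∧ IsCompletion x.1 x.2} : ℝ)
      = (∏ i, (Nat.factorial (d i - 1) : ℝ))
        * ((2 : ℝ) ^ ((∑ i, d i) / 2 - n) * (Nat.factorial ((∑ i, d i) / 2 - n) : ℝ)
            / (Nat.factorial ((∑ i, d i) - n) : ℝ))
        * ((2 : ℝ) ^ (if q = root then 1 else 0) * (multMinusTree g root par q root : ℝ))
        / ((∏ i, (2 : ℝ) ^ (g i i))
            * ∏ x ∈ Finset.univ.filter (fun x : Fin n × Fin n => x.1 ≤ x.2),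
                (Nat.factorial (multMinusTree g root par x.1 x.2) : ℝ)) := by
  have hnum := card_num hn hd g hgsym hgdeg root par ht hspan q hγ
  have hden := card_total hn hd heven hsum
  have hNN : (NN (multMinusTree g root par) root q : ℝ)
      = (2 : ℝ) ^ (if q = root then 1 else 0) * (multMinusTree g root par q root : ℝ) := by
    by_cases h : q = root
    · subst h
      simp [NN]; ring
    · have h' : ¬ root = q := fun h'' => h h''.symm
      have hs : multMinusTree g root par root q = multMinusTree g root par q root := by
        simp only [multMinusTree, treeEdgeNum, h, h', if_false, hgsym root q]
        rw [add_comm]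
      simp [NN, h, h', hs]
  have hDD : (DD (multMinusTree g root par) : ℝ) = ((∏ i, (2 : ℝ) ^ (g i i))
            * ∏ x ∈ Finset.univ.filter (fun x : Fin n × Fin n => x.1 ≤ x.2),
                (Nat.factorial (multMinusTree g root par x.1 x.2) : ℝ)) := by
    simp [DD, multMinusTree]
  have hnum' := congrArg (fun x : ℕ => (x : ℝ)) hnum
  have hden' := congrArg (fun x : ℕ => (x : ℝ)) hden
  simp only [Nat.cast_mul, Nat.cast_pow, Nat.cast_prod, Nat.cast_ofNat] at hnum' hden'
  rw [hNN] at hnum'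
  rw [← hDD]
  have hDpos : (DD (multMinusTree g root par) : ℝ) ≠ 0 := by
    rw [hDD]
    apply mul_ne_zero
    · exact Finset.prod_ne_zero_iff.2 (fun _ _ => by positivity)
    · exact Finset.prod_ne_zero_iff.2 (fun _ _ => by positivity)
  have f1 : ((n - 1).factorial : ℝ) ≠ 0 := by positivity
  have f2 : (((∑ i, d i) - n).factorial : ℝ) ≠ 0 := by positivity
  have hd0 : (Nat.card {x : Path d × (HE d → HE d) //
      IsExecPath d x.1 ∧ IsCompletion x.1 x.2} : ℝ) ≠ 0 := by
    intro h0
    rw [h0, zero_mul] at hden'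
    exact mul_ne_zero f1 f2 hden'.symm
  change (Nat.card {x : Path d × (HE d → HE d) //
          (IsExecPath d x.1 ∧ IsCompletion x.1 x.2) ∧
          TreeEq x.1 root par ∧ GraphEq x.1 x.2 g root par ∧
          (x.2 (rootHE hd root)).1 = q} : ℝ) / _ = _
  generalize (Nat.card {x : Path d × (HE d → HE d) //
          (IsExecPath d x.1 ∧ IsCompletion x.1 x.2) ∧
          TreeEq x.1 root par ∧ GraphEq x.1 x.2 g root par ∧
          (x.2 (rootHE hd root)).1 = q} : ℝ) = X at hnum' ⊢
  generalize (Nat.card {x : Path d × (HE d → HE d) //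
      IsExecPath d x.1 ∧ IsCompletion x.1 x.2} : ℝ) = Y at hden' hd0 ⊢
  generalize (DD (multMinusTree g root par) : ℝ) = D at *
  generalize (2 : ℝ) ^ (if q = root then 1 else 0) * (multMinusTree g root par q root : ℝ) = N at *
  generalize (∏ i, (Nat.factorial (d i - 1) : ℝ)) = P at *
  generalize (2 : ℝ) ^ ((∑ i, d i) / 2 - n) * (Nat.factorial ((∑ i, d i) / 2 - n) : ℝ) = Z at *
  generalize (((∑ i, d i) - n).factorial : ℝ) = W at *
  generalize ((n - 1).factorial : ℝ) = V at *
  rw [← mul_div_assoc, div_mul_eq_mul_div, div_div, div_eq_div_iff hd0 (mul_ne_zero f2 hDpos)]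
  have : V * (X * (W * D)) = V * (P * Z * N * Y) := by
    calc V * (X * (W * D)) = (X * D) * (V * W) := by ring
      _ = (V * P * N) * (Y * Z) := by rw [hnum', hden']
      _ = _ := by ring
  exact mul_left_cancel₀ f1 this

end TWG
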